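/- For every integer s ≥ 1, the q-deformed Dwork congruence holds: [p^s]_q divides T_{s+1}(z,q)·T_{s−1}(z^p,q^p) − T_s(z,q)·T_s(z^p,q^p) in ℤ[z,q]. (Equivalently, T_{s+1}(z,q)/T_s(z^p,q^p) ≡ T_s(z,q)/T_{s−1}(z^p,q^p) mod [p^s]_q.) -/

import Mathlib

open MvPolynomial Finset

/-- Dimension vector of the framed `A_{n-1}` quiver: `v i = min(i, k, n - i)`. -/
def dimv (k n i : ℕ) : ℕ := min i (min k (n - i))

/-- `c_s = (p^s - 1)·ω` where `ω = r₀/q₀` (an integer under the standing hypotheses). -/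
def cExp (p r₀ q₀ s : ℕ) : ℕ := (p ^ s - 1) * r₀ / q₀

/-- `a_s = (p^s - 1)·(1 - ω)`. -/
def aExp (p r₀ q₀ s : ℕ) : ℕ := (p ^ s - 1) - cExp p r₀ q₀ s

/-- `b_s = (p^s - 1)·(1 - 2ω)/2`. -/
def bExp (p r₀ q₀ s : ℕ) : ℕ := (p ^ s - 1 - 2 * cExp p r₀ q₀ s) / 2

/-- The coefficient ring `ℤ[z,q]`, with `z = X false` and `q = X true`. -/
abbrev Zq : Type := MvPolynomial Bool ℤ

noncomputable def Zvar : Zq := MvPolynomial.X false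
noncomputable def Qvar : Zq := MvPolynomial.X true

/-- The superpotential factor `Φ̄_s(x, z, q)`, a polynomial in the variables
`x_{i,j}` (indexed by pairs `(i,j) : ℕ × ℕ`) with coefficients in `ℤ[z,q]`. -/
noncomputable def Phibar (p r₀ q₀ k n s : ℕ) : MvPolynomial (ℕ × ℕ) Zq :=
  (∏ m ∈ Icc 1 (n - 1), ∏ j ∈ Icc 1 (dimv k n m), X (m, j)) ^ aExp p r₀ q₀ s *
  (∏ m ∈ Icc 1 (n - 1),
    ∏ ij ∈ ((Icc 1 (dimv k n m)) ×ˢ (Icc 1 (dimv k n m))).filter (fun ij => ij.1 ≠ ij.2),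
      ∏ r ∈ range (bExp p r₀ q₀ s), (X (m, ij.1) - C (Qvar ^ r) * X (m, ij.2))) *
  (∏ i ∈ Icc 1 (n - 2), ∏ a ∈ Icc 1 (dimv k n i), ∏ b ∈ Icc 1 (dimv k n (i + 1)),
      ∏ r ∈ range (cExp p r₀ q₀ s), (X (i, a) - C (Qvar ^ r) * X (i + 1, b))) *
  (∏ i ∈ Icc 1 k, ∏ r ∈ range (cExp p r₀ q₀ s),
      (C Zvar - C (Qvar ^ r) * X (k, i)) * (1 - C (Qvar ^ r) * X (n - k, i)))

/-- The Vandermonde factor `Δ(x)`. -/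
noncomputable def Vand (k n : ℕ) : MvPolynomial (ℕ × ℕ) Zq :=
  ∏ m ∈ Icc 1 (n - 1),
    ∏ ij ∈ ((Icc 1 (dimv k n m)) ×ˢ (Icc 1 (dimv k n m))).filter (fun ij => ij.1 < ij.2),
      (X (m, ij.2) - X (m, ij.1))

/-- `Φ_s = Δ · Φ̄_s`. -/
noncomputable def Phi (p r₀ q₀ k n s : ℕ) : MvPolynomial (ℕ × ℕ) Zq :=
  Vand k n * Phibar p r₀ q₀ k n s

/-- Exponent vector of the monomial `∏_{i,j} x_{i,j}^{j·p^s - 1}`. -/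
noncomputable def expVec (p k n s : ℕ) : (ℕ × ℕ) →₀ ℕ :=
  ∑ i ∈ Icc 1 (n - 1), ∑ j ∈ Icc 1 (dimv k n i), Finsupp.single (i, j) (j * p ^ s - 1)

/-- The truncation `T_s(z,q) ∈ ℤ[z,q]` of the K-theoretic vertex function of
`T*Gr(k,n)`: the coefficient of `∏ x_{i,j}^{j·p^s - 1}` in `Φ_s(x,z,q)`. -/
noncomputable def Ts (p r₀ q₀ k n s : ℕ) : Zq :=
  MvPolynomial.coeff (expVec p k n s) (Phi p r₀ q₀ k n s)

/-- The ring map `ℤ[z,q] → ℤ[z,q]` sending `z ↦ z^p`, `q ↦ q^p`. -/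
noncomputable def frobZq (p : ℕ) : Zq →+* Zq :=
  MvPolynomial.eval₂Hom (Int.castRingHom Zq) (fun b => (MvPolynomial.X b) ^ p)

section GenericProducts

variable {A B : Type*} [CommRing A] [CommRing B]

/-- The finite `q`-product `∏_{r < c} (x - q^r y)`. -/
def qDiff (c : ℕ) (q x y : A) : A := ∏ r ∈ range c, (x - q ^ r * y)

theorem map_qDiff (φ : A →+* B) (c : ℕ) (q x y : A) :
    φ (qDiff c q x y) = qDiff c (φ q) (φ x) (φ y) := by
  simp [qDiff, map_prod]

theorem qDiff_one (c : ℕ) (x y : A) : qDiff c 1 x y = (x - y) ^ c := by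
  simp [qDiff]

theorem qDiff_add {d : ℕ} {q : A} (hq : q ^ d = 1) (c : ℕ) (x y : A) :
    qDiff (d + c) q x y = qDiff d q x y * qDiff c q x y := by
  simp [qDiff, prod_range_add, pow_add, hq]

theorem qDiff_mul_add {d : ℕ} {q : A} (hq : q ^ d = 1)
    (h : ∀ x y : A, qDiff d q x y = x ^ d - y ^ d) (c c' : ℕ) (x y : A) :
    qDiff (c * d + c') q x y = qDiff c 1 (x ^ d) (y ^ d) * qDiff c' q x y := by
  induction c with
  | zero => simp [qDiff_one]
  | succ c ih =>
    rw [show (c + 1) * d + c' = d + (c * d + c') by ring, qDiff_add hq, ih, h, qDiff_one,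
      qDiff_one, pow_succ]
    ring

theorem IsPrimitiveRoot.qDiff_eq [IsDomain A] {d : ℕ} {q : A} (hd : 0 < d)
    (hq : IsPrimitiveRoot q d) (x y : A) : qDiff d q x y = x ^ d - y ^ d := by
  classical
  rw [hq.pow_sub_pow_eq_prod_sub_mul x y hd, qDiff, Polynomial.nthRootsFinset_def,
    ← Finset.prod_image (s := range d) (g := fun r => q ^ r) (f := fun w => x - w * y)]
  · congr 1
    ext w
    rw [Multiset.mem_toFinset, hq.nthRoots_eq (one_pow d)]
    simp
  · intro a ha b hb hab
    exact hq.pow_inj (by simpa using ha) (by simpa using hb) hab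

/-- The polynomial `Φ̄` with exponents `a`, `b`, `c`, evaluated at `f`, `z`, `q`. -/
def phibarEval (k n a b c : ℕ) (f : ℕ × ℕ → A) (z q : A) : A :=
  (∏ m ∈ Icc 1 (n - 1), ∏ j ∈ Icc 1 (dimv k n m), f (m, j)) ^ a *
  (∏ m ∈ Icc 1 (n - 1),
    ∏ ij ∈ ((Icc 1 (dimv k n m)) ×ˢ (Icc 1 (dimv k n m))).filter (fun ij => ij.1 ≠ ij.2),
      qDiff b q (f (m, ij.1)) (f (m, ij.2))) *
  (∏ i ∈ Icc 1 (n - 2), ∏ a ∈ Icc 1 (dimv k n i), ∏ b ∈ Icc 1 (dimv k n (i + 1)),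
      qDiff c q (f (i, a)) (f (i + 1, b))) *
  (∏ i ∈ Icc 1 k, qDiff c q z (f (k, i)) * qDiff c q 1 (f (n - k, i)))

/-- The Vandermonde product `Δ` evaluated at `f`. -/
def vandEval (k n : ℕ) (f : ℕ × ℕ → A) : A :=
  ∏ m ∈ Icc 1 (n - 1),
    ∏ ij ∈ ((Icc 1 (dimv k n m)) ×ˢ (Icc 1 (dimv k n m))).filter (fun ij => ij.1 < ij.2),
      (f (m, ij.2) - f (m, ij.1))

theorem map_phibarEval (φ : A →+* B) (k n a b c : ℕ) (f : ℕ × ℕ → A) (z q : A) :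
    φ (phibarEval k n a b c f z q) = phibarEval k n a b c (fun x => φ (f x)) (φ z) (φ q) := by
  simp [phibarEval, map_prod, map_qDiff]

theorem map_vandEval (φ : A →+* B) (k n : ℕ) (f : ℕ × ℕ → A) :
    φ (vandEval k n f) = vandEval k n (fun x => φ (f x)) := by
  simp [vandEval, map_prod]

theorem phibarEval_mul_add {d : ℕ} {q : A} (hq : q ^ d = 1)
    (h : ∀ x y : A, qDiff d q x y = x ^ d - y ^ d) (k n a a' b b' c c' : ℕ)
    (f : ℕ × ℕ → A) (z : A) :
    phibarEval k n (a * d + a') (b * d + b') (c * d + c') f z q =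
      phibarEval k n a b c (fun x => f x ^ d) (z ^ d) 1 * phibarEval k n a' b' c' f z q := by
  simp only [phibarEval, qDiff_mul_add hq h, prod_mul_distrib, pow_add, one_pow, pow_mul',
    prod_pow]
  ring

theorem phibarEval_comp {k n : ℕ} (hk : 1 ≤ k) (hn : 2 * k ≤ n) (a b c : ℕ) (f : ℕ × ℕ → A)
    (z q : A) (σ : ℕ → Equiv.Perm ℕ)
    (hσ : ∀ m, {j | σ m j ≠ j} ⊆ (Icc 1 (dimv k n m) : Finset ℕ)) :
    phibarEval k n a b c (fun x => f (x.1, σ x.1 x.2)) z q = phibarEval k n a b c f z q := by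
  have hmem : ∀ m j, σ m j ∈ Icc 1 (dimv k n m) ↔ j ∈ Icc 1 (dimv k n m) := by
    intro m j
    by_cases h : σ m j = j
    · rw [h]
    · have h₁ := hσ m (show j ∈ {j | σ m j ≠ j} from h)
      have h₂ := hσ m (show σ m j ∈ {j | σ m j ≠ j} from fun h' => h ((σ m).injective h'))
      exact iff_of_true h₂ h₁
  have hkk : dimv k n k = k := by simp only [dimv]; omega
  have hnk : dimv k n (n - k) = k := by simp only [dimv]; omega
  simp only [phibarEval, prod_mul_distrib]
  congr 1
  · congr 1
    · congr 1
      · congr 1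
        exact prod_congr rfl fun m _ => (σ m).prod_comp _ (fun j => f (m, j)) (hσ m)
      · refine prod_congr rfl fun m _ => ?_
        refine prod_equiv ((σ m).prodCongr (σ m)) ?_ fun _ _ => rfl
        rintro ⟨i, j⟩
        simp only [mem_filter, mem_product, Equiv.prodCongr_apply, Prod.map, hmem, ne_eq,
          (σ m).injective.eq_iff]
    · refine prod_congr rfl fun m _ => ?_
      refine Eq.trans (prod_congr rfl fun i _ => ?_) ((σ m).prod_comp _ (fun i =>
        ∏ j ∈ Icc 1 (dimv k n (m + 1)), qDiff c q (f (m, i)) (f (m + 1, j))) (hσ m))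
      exact (σ (m + 1)).prod_comp _ (fun j => qDiff c q (f (m, σ m i)) (f (m + 1, j)))
        (hσ (m + 1))
  · congr 1
    · exact (σ k).prod_comp _ (fun j => qDiff c q z (f (k, j))) (by simpa [hkk] using hσ k)
    · exact (σ (n - k)).prod_comp _ (fun j => qDiff c q 1 (f (n - k, j)))
        (by simpa [hnk] using hσ (n - k))

/-- The permutation of the index set exchanging `(m, a)` and `(m, a + 1)`. -/
def rowSwap (m a m' : ℕ) : Equiv.Perm ℕ := if m' = m then Equiv.swap a (a + 1) else 1

theorem rowSwap_support {k n m a : ℕ} (ha : 1 ≤ a) (ha' : a + 1 ≤ dimv k n m) (m' : ℕ) :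
    {j | rowSwap m a m' j ≠ j} ⊆ (Icc 1 (dimv k n m') : Finset ℕ) := by
  intro j hj
  simp only [rowSwap, Set.mem_ofPred_eq] at hj
  split_ifs at hj with h
  · subst h
    rw [Equiv.swap_apply_def] at hj
    simp only [coe_Icc, Set.mem_Icc]
    split_ifs at hj <;> omega
  · simp at hj

theorem vandEval_rowSwap {k n m a : ℕ} (hm : m ∈ Icc 1 (n - 1)) (ha : 1 ≤ a)
    (ha' : a + 1 ≤ dimv k n m) (f : ℕ × ℕ → A) :
    vandEval k n (fun x => f (x.1, rowSwap m a x.1 x.2)) = -vandEval k n f := by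
  simp only [vandEval]
  rw [← mul_prod_erase _ _ hm, ← mul_prod_erase _ _ hm, neg_mul_eq_neg_mul]
  congr 1
  · have hmem : ((a, a + 1) : ℕ × ℕ) ∈
        ((Icc 1 (dimv k n m)) ×ˢ (Icc 1 (dimv k n m))).filter (fun ij => ij.1 < ij.2) := by
      simp only [mem_filter, mem_product, mem_Icc]; omega
    rw [← mul_prod_erase _ _ hmem, ← mul_prod_erase _ _ hmem, neg_mul_eq_neg_mul]
    congr 1
    · simp [rowSwap]
    · refine prod_equiv ((rowSwap m a m).prodCongr (rowSwap m a m)) ?_ fun _ _ => rfl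
      rintro ⟨i, j⟩
      simp only [rowSwap, if_true, mem_erase, mem_filter, mem_product, mem_Icc,
        Equiv.prodCongr_apply, Prod.map, Equiv.swap_apply_def, ne_eq, Prod.mk.injEq]
      split_ifs <;> omega
  · refine prod_congr rfl fun m' hm' => ?_
    simp [rowSwap, (mem_erase.1 hm').1]

end GenericProducts

section ExpandCoefficients

variable {σ R : Type*} [CommRing R]

theorem exists_coeff_eq_of_injective (F : MvPolynomial σ R) {E : (σ →₀ ℕ) → σ →₀ ℕ}
    (hE : Function.Injective E) : ∃ G : MvPolynomial σ R, ∀ l, coeff l G = coeff (E l) F := by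
  classical
  refine ⟨∑ l ∈ F.support.preimage E hE.injOn, monomial l (coeff (E l) F), fun l => ?_⟩
  simp only [coeff_sum, coeff_monomial, sum_ite_eq', mem_preimage, mem_support_iff]
  split_ifs with h
  · rfl
  · exact (not_not.1 h).symm

theorem smul_add_smul_injective {d : ℕ} (hd : 0 < d) (e : σ →₀ ℕ) :
    Function.Injective fun l : σ →₀ ℕ => d • l + (d - 1) • e := by
  intro l l' h
  ext x
  have := DFunLike.congr_fun h x
  simpa [hd.ne'] using this

theorem coeff_expand_mul {d : ℕ} (hd : 0 < d) {e : σ →₀ ℕ} (he : ∀ x, e x ≤ 1)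
    {F G : MvPolynomial σ R} (hG : ∀ l, coeff l G = coeff (d • l + (d - 1) • e) F)
    (H : MvPolynomial σ R) (t : σ →₀ ℕ) :
    coeff (d • t + (d - 1) • e) (expand d H * F) = coeff t (H * G) := by
  induction H using MvPolynomial.induction_on' with
  | monomial u r =>
    have hle : d • u ≤ d • t + (d - 1) • e ↔ u ≤ t := by
      constructor
      · intro h x
        have h₁ := h x
        have h₂ := he x
        simp only [Finsupp.coe_add, Finsupp.coe_smul, Pi.add_apply, Pi.smul_apply,
          smul_eq_mul] at h₁
        by_contra! h₃
        have h₄ : d * (t x + 1) ≤ d * u x := Nat.mul_le_mul_left _ h₃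
        have h₅ : (d - 1) * e x ≤ (d - 1) * 1 := Nat.mul_le_mul_left _ h₂
        rw [mul_add] at h₄
        omega
      · intro h x
        have h₁ : d * u x ≤ d * t x := Nat.mul_le_mul_left _ (h x)
        simp only [Finsupp.coe_add, Finsupp.coe_smul, Pi.add_apply, Pi.smul_apply, smul_eq_mul]
        omega
    rw [expand_monomial, coeff_monomial_mul', coeff_monomial_mul']
    simp only [hle]
    split_ifs with h
    · rw [hG]
      congr 2
      ext x
      have h₁ : d * u x ≤ d * t x := Nat.mul_le_mul_left _ (h x)
      simp only [Finsupp.coe_add, Finsupp.coe_smul, Finsupp.coe_tsub, Pi.add_apply, Pi.sub_apply,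
        Pi.smul_apply, smul_eq_mul, Nat.mul_sub]
      omega
    · rfl
  | add p q hp hq => rw [map_add, add_mul, add_mul, coeff_add, coeff_add, hp, hq]

end ExpandCoefficients

section Alternating

variable {R : Type*} [CommRing R]

/-- The transposition of the variables `x_{m,a}` and `x_{m,a+1}`. -/
def indexSwap (m a : ℕ) : Equiv.Perm (ℕ × ℕ) := Equiv.swap (m, a) (m, a + 1)

theorem indexSwap_apply (m a : ℕ) (x : ℕ × ℕ) :
    indexSwap m a x = (x.1, rowSwap m a x.1 x.2) := by
  obtain ⟨i, j⟩ := x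
  simp only [indexSwap, rowSwap, Equiv.swap_apply_def, Prod.mk.injEq]
  by_cases h : i = m
  · subst h
    simp only [true_and, if_true, Equiv.swap_apply_def]
    split_ifs <;> rfl
  · simp [h]

/-- `F` changes sign under each exchange of two consecutive variables of the same row. -/
def IsRowAlternating (k n : ℕ) (F : MvPolynomial (ℕ × ℕ) R) : Prop :=
  ∀ m a, m ∈ Icc 1 (n - 1) → 1 ≤ a → a + 1 ≤ dimv k n m → ∀ l : ℕ × ℕ →₀ ℕ,
    coeff (l.mapDomain (indexSwap m a)) F = -coeff l F

/-- Each exponent of `F` in a variable of row `m` is smaller than the length of that row. -/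
def IsRowReduced (k n : ℕ) (F : MvPolynomial (ℕ × ℕ) R) : Prop :=
  ∀ l ∈ F.support, ∀ m j, if j ∈ Icc 1 (dimv k n m) then l (m, j) < dimv k n m else l (m, j) = 0

theorem mem_Icc_of_dimv_pos {k n m : ℕ} (h : 0 < dimv k n m) : m ∈ Icc 1 (n - 1) := by
  simp only [dimv] at h
  rw [mem_Icc]
  omega

theorem sum_single_apply (k n : ℕ) (g : ℕ → ℕ → ℕ) (m j : ℕ) :
    (∑ i ∈ Icc 1 (n - 1), ∑ j ∈ Icc 1 (dimv k n i), Finsupp.single (i, j) (g i j)) (m, j) =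
      if j ∈ Icc 1 (dimv k n m) then g m j else 0 := by
  classical
  simp only [Finsupp.finsetSum_apply, Finsupp.single_apply, Prod.mk.injEq]
  have h : ∀ i ∈ Icc 1 (n - 1), (∑ j' ∈ Icc 1 (dimv k n i),
      if i = m ∧ j' = j then g i j' else 0) =
      if i = m then (if j ∈ Icc 1 (dimv k n m) then g m j else 0) else 0 := by
    intro i _
    by_cases h : i = m
    · subst h
      simp
    · simp [h]
  rw [sum_congr rfl h, sum_ite_eq']
  split_ifs with h₁ h₂ h₂
  · rfl
  · rfl
  · exact absurd (mem_Icc_of_dimv_pos (k := k) (by rw [mem_Icc] at h₂; omega)) h₁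
  · rfl

theorem expVec_apply (p k n s m j : ℕ) :
    expVec p k n s (m, j) = if j ∈ Icc 1 (dimv k n m) then j * p ^ s - 1 else 0 :=
  sum_single_apply k n (fun _ j => j * p ^ s - 1) m j

theorem IsRowAlternating.eq_zero [IsDomain R] [CharZero R] {k n : ℕ} (p : ℕ)
    {F : MvPolynomial (ℕ × ℕ) R} (hF : IsRowAlternating k n F) (hF' : IsRowReduced k n F)
    (h₀ : coeff (expVec p k n 0) F = 0) : F = 0 := by
  classical
  by_contra hne
  have hlt : ∀ m, dimv k n m ≤ k := fun m => by simp only [dimv]; omega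
  obtain ⟨l, hl, hmax⟩ := exists_max_image F.support
    (fun l => ∑ x ∈ range n ×ˢ range (k + 1), x.2 * l x) (support_nonempty.2 hne)
  have hstep : ∀ m a, 1 ≤ a → a + 1 ≤ dimv k n m → l (m, a) + 1 ≤ l (m, a + 1) := by
    intro m a ha ha'
    have hm : m ∈ Icc 1 (n - 1) := mem_Icc_of_dimv_pos (k := k) (by omega)
    have halt := hF m a hm ha ha' l
    have happ : ∀ x, l.mapDomain (indexSwap m a) x = l (indexSwap m a x) := fun x => by
      rw [Finsupp.mapDomain_equiv_apply, indexSwap, Equiv.symm_swap]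
    have h₁ : indexSwap m a (m, a) = (m, a + 1) := Equiv.swap_apply_left _ _
    have h₂ : indexSwap m a (m, a + 1) = (m, a) := Equiv.swap_apply_right _ _
    have h₃ : ∀ x, x ≠ (m, a) → x ≠ (m, a + 1) → indexSwap m a x = x :=
      fun x => Equiv.swap_apply_of_ne_of_ne
    by_contra! hlt'
    rcases (Nat.lt_succ_iff.1 hlt').eq_or_lt with heq | hgt
    · have : l.mapDomain (indexSwap m a) = l := by
        ext x
        rw [happ]
        by_cases hx : x = (m, a)
        · rw [hx, h₁, heq]
        by_cases hx' : x = (m, a + 1)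
        · rw [hx', h₂, heq]
        rw [h₃ x hx hx']
      rw [this] at halt
      exact mem_support_iff.1 hl (self_eq_neg.1 halt)
    · have hmem : l.mapDomain (indexSwap m a) ∈ F.support := by
        rw [mem_support_iff, halt, neg_ne_zero]
        exact mem_support_iff.1 hl
      have hle := hmax _ hmem
      have hA : (m, a) ∈ range n ×ˢ range (k + 1) := by
        have := hlt m
        simp only [mem_product, mem_range, mem_Icc] at hm ⊢
        omega
      have hB : (m, a + 1) ∈ (range n ×ˢ range (k + 1)).erase (m, a) := by
        have := hlt m
        simp only [mem_erase, mem_product, mem_range, mem_Icc, ne_eq, Prod.mk.injEq] at hm ⊢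
        omega
      rw [← add_sum_erase _ _ hA, ← add_sum_erase _ _ hB,
        ← add_sum_erase (range n ×ˢ range (k + 1)) _ hA, ← add_sum_erase _ (fun x => x.2 * l x) hB,
        happ, happ, h₁, h₂,
        sum_congr rfl fun x hx => by
          rw [happ, h₃ x (mem_erase.1 (mem_erase.1 hx).2).1 (mem_erase.1 hx).1]] at hle
      simp only at hle
      nlinarith
  have hchain : ∀ m j t, 1 ≤ j → j + t ≤ dimv k n m → l (m, j) + t ≤ l (m, j + t) := by
    intro m j t hj ht
    induction t with
    | zero => simp
    | succ t ih =>
      have h₁ := ih (by omega)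
      have h₂ := hstep m (j + t) (by omega) (by omega)
      rw [← add_assoc j t 1]
      omega
  have hl_eq : l = expVec p k n 0 := by
    ext ⟨m, j⟩
    rw [expVec_apply]
    have hlmj := hF' l hl m j
    split_ifs at hlmj ⊢ with hj
    · rw [mem_Icc] at hj
      have h₁ := hchain m 1 (j - 1) le_rfl (by omega)
      have h₂ := hchain m j (dimv k n m - j) hj.1 (by omega)
      have h₃ := hF' l hl m (dimv k n m)
      rw [if_pos (by rw [mem_Icc]; omega)] at h₃
      rw [show 1 + (j - 1) = j by omega] at h₁
      rw [show j + (dimv k n m - j) = dimv k n m by omega] at h₂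
      rw [pow_zero, mul_one]
      omega
    · exact hlmj
  rw [mem_support_iff, hl_eq] at hl
  exact hl h₀

end Alternating

section Degrees

theorem sum_offDiag_left {ι : Type*} [DecidableEq ι] (s : Finset ι) (g : ι → ℕ) :
    ∑ ij ∈ (s ×ˢ s).filter (fun ij => ij.1 ≠ ij.2), (g ij.1 + g ij.2) =
      2 * ((#s - 1) * ∑ i ∈ s, g i) := by
  have h₁ : ∑ ij ∈ (s ×ˢ s).filter (fun ij => ij.1 ≠ ij.2), g ij.1 = (#s - 1) * ∑ i ∈ s, g i := by
    rw [sum_filter, sum_product, mul_sum]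
    refine sum_congr rfl fun i hi => ?_
    rw [← sum_filter]
    change ∑ j ∈ s with i ≠ j, g i = _
    rw [sum_const, filter_ne, card_erase_of_mem hi, smul_eq_mul]
  have h₂ : ∑ ij ∈ (s ×ˢ s).filter (fun ij => ij.1 ≠ ij.2), g ij.2 =
      ∑ ij ∈ (s ×ˢ s).filter (fun ij => ij.1 ≠ ij.2), g ij.1 := by
    refine sum_equiv (Equiv.prodComm ι ι) ?_ fun _ _ => rfl
    rintro ⟨i, j⟩
    simp only [mem_filter, mem_product, Equiv.prodComm_apply, Prod.swap]
    tauto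
  rw [sum_add_distrib, h₂, h₁, two_mul]

theorem sum_lt_pairs {ι : Type*} [LinearOrder ι] (s : Finset ι) (g : ι → ℕ) :
    ∑ ij ∈ (s ×ˢ s).filter (fun ij => ij.1 < ij.2), (g ij.1 + g ij.2) =
      (#s - 1) * ∑ i ∈ s, g i := by
  have h := sum_offDiag_left s g
  have hsplit : (s ×ˢ s).filter (fun ij => ij.1 ≠ ij.2) =
      (s ×ˢ s).filter (fun ij => ij.1 < ij.2) ∪ (s ×ˢ s).filter (fun ij => ij.2 < ij.1) := by
    rw [← filter_or]
    exact filter_congr fun ij _ => ne_iff_lt_or_gt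
  rw [hsplit, sum_union] at h
  · have h₂ : ∑ ij ∈ (s ×ˢ s).filter (fun ij => ij.2 < ij.1), (g ij.1 + g ij.2) =
        ∑ ij ∈ (s ×ˢ s).filter (fun ij => ij.1 < ij.2), (g ij.1 + g ij.2) := by
      refine sum_equiv (Equiv.prodComm ι ι) ?_ fun _ _ => add_comm _ _
      rintro ⟨i, j⟩
      simp only [mem_filter, mem_product, Equiv.prodComm_apply, Prod.swap]
      tauto
    omega
  · rw [disjoint_filter]
    exact fun ij _ h₁ h₂ => lt_asymm h₁ h₂

variable {R : Type*} [CommRing R]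

theorem degreeOf_qDiff_le {σ : Type*} (x : σ) (c : ℕ) (q : R) (f g : MvPolynomial σ R) :
    degreeOf x (qDiff c (C q) f g) ≤ c * (degreeOf x f + degreeOf x g) := by
  refine (degreeOf_prod_le _ _ _).trans ((sum_le_card_nsmul _ _ _ fun r _ => ?_).trans
    (by rw [card_range, smul_eq_mul]))
  refine (degreeOf_sub_le _ _ _).trans (max_le (Nat.le_add_right _ _) ?_)
  rw [← C_pow]
  exact (degreeOf_C_mul_le _ _ _).trans (Nat.le_add_left _ _)

variable [Nontrivial R]

theorem sum_degreeOf_row (k n m j i : ℕ) :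
    ∑ a ∈ Icc 1 (dimv k n i), degreeOf (m, j) (X (i, a) : MvPolynomial (ℕ × ℕ) R) =
      if i = m then (if j ∈ Icc 1 (dimv k n m) then 1 else 0) else 0 := by
  classical
  simp only [degreeOf_X, Prod.mk.injEq]
  by_cases h : i = m
  · subst h
    simp
  · simp [h, Ne.symm h]

theorem degreeOf_vandEval_le (k n m j : ℕ) :
    degreeOf (m, j) (vandEval k n (X : ℕ × ℕ → MvPolynomial (ℕ × ℕ) R)) ≤
      (dimv k n m - 1) * if j ∈ Icc 1 (dimv k n m) then 1 else 0 := by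
  refine (degreeOf_prod_le _ _ _).trans ?_
  have h : ∀ i ∈ Icc 1 (n - 1), degreeOf (m, j)
      (∏ ij ∈ ((Icc 1 (dimv k n i)) ×ˢ (Icc 1 (dimv k n i))).filter (fun ij => ij.1 < ij.2),
        (X (i, ij.2) - X (i, ij.1) : MvPolynomial (ℕ × ℕ) R)) ≤
      if i = m then (dimv k n m - 1) * (if j ∈ Icc 1 (dimv k n m) then 1 else 0) else 0 := by
    intro i _
    refine (degreeOf_prod_le _ _ _).trans ((sum_le_sum fun ij _ =>
      (degreeOf_sub_le _ _ _).trans (max_le (Nat.le_add_left _ _) (Nat.le_add_right _ _))).trans ?_)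
    rw [sum_lt_pairs _ (fun a => degreeOf (m, j) (X (i, a) : MvPolynomial (ℕ × ℕ) R)),
      sum_degreeOf_row, Nat.card_Icc, Nat.add_sub_cancel]
    split_ifs with h <;> simp_all
  refine (sum_le_sum h).trans ?_
  rw [sum_ite_eq']
  split_ifs <;> simp

theorem degreeOf_phibarEval_le {k n : ℕ} (hk : 1 ≤ k) (hn : 2 * k ≤ n) (a b c : ℕ) (z q : R)
    (m j : ℕ) :
    degreeOf (m, j) (phibarEval k n a b c (X : ℕ × ℕ → MvPolynomial (ℕ × ℕ) R) (C z) (C q)) ≤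
      (a + 2 * (b * (dimv k n m - 1)) + 2 * (c * dimv k n m)) *
        if j ∈ Icc 1 (dimv k n m) then 1 else 0 := by
  set e := if j ∈ Icc 1 (dimv k n m) then 1 else 0 with he
  have hrow : ∀ i, ∑ a ∈ Icc 1 (dimv k n i),
      degreeOf (m, j) (X (i, a) : MvPolynomial (ℕ × ℕ) R) = if i = m then e else 0 :=
    sum_degreeOf_row k n m j
  have hite : ∀ (s : Finset ℕ) (g : ℕ), ∑ i ∈ s, (if i = m then g else 0) ≤ g := by
    intro s g
    rw [sum_ite_eq']
    split_ifs <;> simp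
  have h₁ : degreeOf (m, j) ((∏ i ∈ Icc 1 (n - 1), ∏ t ∈ Icc 1 (dimv k n i),
      (X (i, t) : MvPolynomial (ℕ × ℕ) R)) ^ a) ≤ a * e := by
    refine (degreeOf_pow_le _ _ _).trans (Nat.mul_le_mul_left _ ?_)
    refine (degreeOf_prod_le _ _ _).trans ((sum_le_sum fun i _ =>
      (degreeOf_prod_le _ _ _).trans (hrow i).le).trans (hite _ _))
  have h₂ : degreeOf (m, j) (∏ i ∈ Icc 1 (n - 1),
      ∏ ij ∈ ((Icc 1 (dimv k n i)) ×ˢ (Icc 1 (dimv k n i))).filter (fun ij => ij.1 ≠ ij.2),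
        qDiff b (C q) (X (i, ij.1) : MvPolynomial (ℕ × ℕ) R) (X (i, ij.2))) ≤
      2 * (b * (dimv k n m - 1)) * e := by
    refine (degreeOf_prod_le _ _ _).trans ((sum_le_sum fun i _ => ?_).trans (hite _ _))
    refine (degreeOf_prod_le _ _ _).trans ((sum_le_sum fun ij _ =>
      degreeOf_qDiff_le _ _ _ _ _).trans ?_)
    rw [← mul_sum, sum_offDiag_left _
      (fun a => degreeOf (m, j) (X (i, a) : MvPolynomial (ℕ × ℕ) R)), hrow, Nat.card_Icc,
      Nat.add_sub_cancel]
    split_ifs with h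
    · rw [h]
      exact le_of_eq (by ring)
    · simp
  have h₃ : degreeOf (m, j) (∏ i ∈ Icc 1 (n - 2), ∏ a ∈ Icc 1 (dimv k n i),
      ∏ b ∈ Icc 1 (dimv k n (i + 1)),
        qDiff c (C q) (X (i, a) : MvPolynomial (ℕ × ℕ) R) (X (i + 1, b))) ≤
      c * (dimv k n (m + 1) + dimv k n (m - 1)) * e := by
    refine (degreeOf_prod_le _ _ _).trans ((sum_le_sum (g := fun i =>
      (if i = m then c * dimv k n (m + 1) * e else 0) +
        if i = m - 1 ∧ 1 ≤ m then c * dimv k n (m - 1) * e else 0) fun i _ => ?_).trans ?_)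
    · refine (degreeOf_prod_le _ _ _).trans ((sum_le_sum fun a _ =>
        (degreeOf_prod_le _ _ _).trans (sum_le_sum fun b _ =>
          degreeOf_qDiff_le _ _ _ _ _)).trans ?_)
      simp only [← mul_sum, sum_add_distrib, sum_const, Nat.card_Icc, Nat.add_sub_cancel,
        smul_eq_mul, hrow]
      have h₄ : i + 1 = m ↔ i = m - 1 ∧ 1 ≤ m := by omega
      simp only [h₄]
      by_cases h₅ : i = m
      · subst h₅
        have h₆ : ¬(i = i - 1 ∧ 1 ≤ i) := by omega
        simp only [h₆, if_true, if_false]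
        exact le_of_eq (by ring)
      · by_cases h₆ : i = m - 1 ∧ 1 ≤ m
        · rw [if_neg h₅, if_neg h₅, if_pos h₆, if_pos h₆, h₆.1]
          exact le_of_eq (by ring)
        · simp [h₅, h₆]
    · rw [sum_add_distrib, mul_add, add_mul]
      refine add_le_add (hite _ _) ?_
      by_cases hm : 1 ≤ m
      · simp only [hm, and_true, sum_ite_eq']
        split_ifs <;> simp
      · simp [hm]
  have hkk : dimv k n k = k := by simp only [dimv]; omega
  have hnk : dimv k n (n - k) = k := by simp only [dimv]; omega
  have h₄ : degreeOf (m, j) (∏ i ∈ Icc 1 k, qDiff c (C q) (C z)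
      (X (k, i) : MvPolynomial (ℕ × ℕ) R) * qDiff c (C q) 1 (X (n - k, i))) ≤
      c * ((if k = m then 1 else 0) + if n - k = m then 1 else 0) * e := by
    refine (degreeOf_prod_le _ _ _).trans ((sum_le_sum fun i _ =>
      (degreeOf_mul_le _ _ _).trans (add_le_add (degreeOf_qDiff_le _ _ _ _ _)
        (degreeOf_qDiff_le _ _ _ _ _))).trans ?_)
    have h₁ := hrow k
    have h₂ := hrow (n - k)
    rw [hkk] at h₁
    rw [hnk] at h₂
    rw [sum_add_distrib, ← mul_sum, ← mul_sum, sum_add_distrib, sum_add_distrib, h₁, h₂]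
    simp only [degreeOf_C, degreeOf_one, sum_const_zero, zero_add]
    split_ifs <;> exact le_of_eq (by ring)
  have hdim : j ∈ Icc 1 (dimv k n m) → (dimv k n (m + 1) + dimv k n (m - 1)) +
      ((if k = m then 1 else 0) + if n - k = m then 1 else 0) ≤ 2 * dimv k n m := by
    rw [mem_Icc]
    simp only [dimv]
    intro h
    split_ifs <;> omega
  have htot : c * (dimv k n (m + 1) + dimv k n (m - 1)) * e +
      c * ((if k = m then 1 else 0) + if n - k = m then 1 else 0) * e ≤
      2 * (c * dimv k n m) * e := by
    by_cases h : j ∈ Icc 1 (dimv k n m)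
    · rw [← add_mul, ← mul_add, mul_left_comm 2]
      exact Nat.mul_le_mul_right _ (Nat.mul_le_mul_left _ (hdim h))
    · simp [he, h]
  calc _ ≤ a * e + 2 * (b * (dimv k n m - 1)) * e +
        c * (dimv k n (m + 1) + dimv k n (m - 1)) * e +
        c * ((if k = m then 1 else 0) + if n - k = m then 1 else 0) * e :=
      (degreeOf_mul_le _ _ _).trans (add_le_add ((degreeOf_mul_le _ _ _).trans
        (add_le_add ((degreeOf_mul_le _ _ _).trans (add_le_add h₁ h₂)) h₃)) h₄)
    _ ≤ _ := by
      rw [add_mul, add_mul, add_assoc]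
      exact add_le_add le_rfl htot

end Degrees

section Factorization

variable {K : Type*} [CommRing K]

/-- The product `Δ · Φ̄` with exponents `a`, `b`, `c`, as a polynomial in the variables `x`. -/
noncomputable def phiPoly (k n a b c : ℕ) (z q : K) : MvPolynomial (ℕ × ℕ) K :=
  vandEval k n X * phibarEval k n a b c X (C z) (C q)

/-- The indicator vector of the set of variables which occur. -/
noncomputable def indVec (k n : ℕ) : ℕ × ℕ →₀ ℕ :=
  ∑ i ∈ Icc 1 (n - 1), ∑ j ∈ Icc 1 (dimv k n i), Finsupp.single (i, j) 1

theorem indVec_apply (k n m j : ℕ) :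
    indVec k n (m, j) = if j ∈ Icc 1 (dimv k n m) then 1 else 0 :=
  sum_single_apply k n (fun _ _ => 1) m j

theorem phiPoly_zero (k n : ℕ) (z q : K) :
    phiPoly k n 0 0 0 z q = vandEval k n (X : ℕ × ℕ → MvPolynomial (ℕ × ℕ) K) := by
  simp [phiPoly, phibarEval, qDiff]

theorem isRowAlternating_phiPoly {k n : ℕ} (hk : 1 ≤ k) (hn : 2 * k ≤ n) (a b c : ℕ) (z q : K) :
    IsRowAlternating k n (phiPoly k n a b c z q) := by
  intro m t hm ht ht' l
  have h : rename (indexSwap m t) (phiPoly k n a b c z q) = -phiPoly k n a b c z q := by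
    change (rename (indexSwap m t)).toRingHom _ = _
    rw [phiPoly, map_mul, map_vandEval, map_phibarEval]
    simp only [AlgHom.toRingHom_eq_coe, RingHom.coe_coe, rename_X, rename_C, indexSwap_apply]
    rw [phibarEval_comp hk hn a b c X _ _ _ (rowSwap_support ht ht'),
      vandEval_rowSwap hm ht ht' X, neg_mul]
  rw [← coeff_rename_mapDomain _ (indexSwap m t).injective (phiPoly k n a b c z q) l, h,
    coeff_neg, neg_neg]

theorem isRowAlternating_of_coeff_eq {k n : ℕ} (d : ℕ) {F G : MvPolynomial (ℕ × ℕ) K}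
    (hF : IsRowAlternating k n F)
    (hG : ∀ l, coeff l G = coeff (d • l + (d - 1) • indVec k n) F) :
    IsRowAlternating k n G := by
  intro m t hm ht ht' l
  have hind : (indVec k n).mapDomain (indexSwap m t) = indVec k n := by
    ext x
    rw [Finsupp.mapDomain_equiv_apply, indexSwap, Equiv.symm_swap, Equiv.swap_apply_def]
    split_ifs with h h <;> simp only [h, indVec_apply, mem_Icc] <;> split_ifs <;> omega
  rw [hG, hG, ← hF m t hm ht ht', Finsupp.mapDomain_add, Finsupp.mapDomain_smul,
    Finsupp.mapDomain_smul, hind]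

theorem isRowReduced_of_coeff_eq [Nontrivial K] {k n : ℕ} (hk : 1 ≤ k) (hn : 2 * k ≤ n)
    {a b c d : ℕ} (hd : 0 < d)
    (hdeg : ∀ v, 1 ≤ v → v - 1 + (a + 2 * (b * (v - 1)) + 2 * (c * v)) + 1 < (v + 1) * d)
    {z q : K} {G : MvPolynomial (ℕ × ℕ) K}
    (hG : ∀ l, coeff l G = coeff (d • l + (d - 1) • indVec k n) (phiPoly k n a b c z q)) :
    IsRowReduced k n G := by
  intro l hl m j
  rw [mem_support_iff, hG, ← mem_support_iff] at hl
  have h₁ := (monomial_le_degreeOf (m, j) hl).trans ((degreeOf_mul_le _ _ _).trans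
    (add_le_add (degreeOf_vandEval_le k n m j) (degreeOf_phibarEval_le hk hn a b c z q m j)))
  simp only [Finsupp.coe_add, Finsupp.coe_smul, Pi.add_apply, Pi.smul_apply, smul_eq_mul,
    indVec_apply] at h₁
  split_ifs at h₁ ⊢ with h
  · have h₂ := hdeg (dimv k n m) (by rw [mem_Icc] at h; omega)
    have h₃ : d * (l (m, j) + 1) < d * (dimv k n m + 1) := by
      rw [mul_comm d (dimv k n m + 1), mul_add]
      omega
    have h₄ := Nat.lt_of_mul_lt_mul_left h₃
    omega
  · simpa [hd.ne'] using h₁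

theorem coeff_mul_phiPoly_eq [IsDomain K] [CharZero K] {k n : ℕ} (hk : 1 ≤ k) (hn : 2 * k ≤ n)
    (p : ℕ) {a b c d : ℕ} (hd : 0 < d)
    (hdeg : ∀ v, 1 ≤ v → v - 1 + (a + 2 * (b * (v - 1)) + 2 * (c * v)) + 1 < (v + 1) * d)
    (z q : K) (H : MvPolynomial (ℕ × ℕ) K) (t : ℕ × ℕ →₀ ℕ) :
    coeff (expVec p k n 0) (vandEval k n (X : ℕ × ℕ → MvPolynomial (ℕ × ℕ) K)) *
        coeff (d • t + (d - 1) • indVec k n) (expand d H * phiPoly k n a b c z q) =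
      coeff t (H * vandEval k n X) *
        coeff (d • expVec p k n 0 + (d - 1) • indVec k n) (phiPoly k n a b c z q) := by
  obtain ⟨G, hG⟩ := exists_coeff_eq_of_injective (phiPoly k n a b c z q)
    (smul_add_smul_injective hd (indVec k n))
  set V := vandEval k n (X : ℕ × ℕ → MvPolynomial (ℕ × ℕ) K) with hV
  have hV' : ∀ l, coeff l V = coeff (1 • l + (1 - 1) • indVec k n) (phiPoly k n 0 0 0 z q) := by
    simp [phiPoly_zero, hV]
  have hVa := isRowAlternating_of_coeff_eq 1 (isRowAlternating_phiPoly hk hn 0 0 0 z q) hV'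
  have hVr := isRowReduced_of_coeff_eq hk hn one_pos (fun v _ => by omega) hV'
  have hGa := isRowAlternating_of_coeff_eq d (isRowAlternating_phiPoly hk hn a b c z q) hG
  have hGr := isRowReduced_of_coeff_eq hk hn hd hdeg hG
  have hzero : C (coeff (expVec p k n 0) V) * G - C (coeff (expVec p k n 0) G) * V = 0 := by
    refine IsRowAlternating.eq_zero (k := k) (n := n) p ?_ ?_ ?_
    · intro m t hm ht ht' l
      simp only [coeff_sub, coeff_C_mul, hGa m t hm ht ht', hVa m t hm ht ht']
      ring
    · intro l hl
      by_cases h : l ∈ G.support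
      · exact hGr l h
      by_cases h' : l ∈ V.support
      · exact hVr l h'
      · rw [mem_support_iff, not_not] at h h'
        simp [mem_support_iff, coeff_C_mul, h, h'] at hl
    · simp only [coeff_sub, coeff_C_mul]
      ring
  rw [coeff_expand_mul hd (fun x => by rw [indVec_apply]; split_ifs <;> simp) hG, ← coeff_C_mul,
    ← hG, mul_comm (coeff t _), ← coeff_C_mul, mul_left_comm, sub_eq_zero.1 hzero, mul_left_comm]

theorem coeff_vandEval_ne_zero [IsDomain K] [CharZero K] {k n : ℕ} (hk : 1 ≤ k)
    (hn : 2 * k ≤ n) (p : ℕ) :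
    coeff (expVec p k n 0) (vandEval k n (X : ℕ × ℕ → MvPolynomial (ℕ × ℕ) K)) ≠ 0 := by
  have hV : ∀ l, coeff l (vandEval k n (X : ℕ × ℕ → MvPolynomial (ℕ × ℕ) K)) =
      coeff (1 • l + (1 - 1) • indVec k n) (phiPoly k n 0 0 0 0 0) := by
    simp [phiPoly_zero]
  intro h
  have h₀ := IsRowAlternating.eq_zero p
    (isRowAlternating_of_coeff_eq 1 (isRowAlternating_phiPoly hk hn 0 0 0 0 0) hV)
    (isRowReduced_of_coeff_eq hk hn one_pos (fun v _ => by omega) hV) h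
  revert h₀
  simp only [vandEval, prod_eq_zero_iff, sub_eq_zero]
  rintro ⟨m, _, ij, hij, h'⟩
  have := X_injective h'
  simp only [mem_filter, Prod.mk.injEq] at hij this
  omega

end Factorization

section Truncation

variable {K : Type*} [CommRing K]

/-- The truncation `T_s`, with parameters `z` and `q` in a commutative ring. -/
noncomputable def truncEval (p r₀ q₀ k n s : ℕ) (z q : K) : K :=
  coeff (expVec p k n s)
    (phiPoly k n (aExp p r₀ q₀ s) (bExp p r₀ q₀ s) (cExp p r₀ q₀ s) z q)

theorem map_Ts (φ : Zq →+* K) (p r₀ q₀ k n s : ℕ) :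
    φ (Ts p r₀ q₀ k n s) = truncEval p r₀ q₀ k n s (φ Zvar) (φ Qvar) := by
  have h : Phi p r₀ q₀ k n s = vandEval k n X *
      phibarEval k n (aExp p r₀ q₀ s) (bExp p r₀ q₀ s) (cExp p r₀ q₀ s) X (C Zvar) (C Qvar) := by
    simp only [Phi, Vand, Phibar, vandEval, phibarEval, qDiff, C_pow, prod_mul_distrib]
  rw [Ts, ← coeff_map, h, map_mul, map_vandEval, map_phibarEval]
  simp only [map_X, map_C]
  rfl

theorem cExp_mul {p q₀ : ℕ} (r₀ : ℕ) (hp : 1 ≤ p) (hcong : p ≡ 1 [MOD q₀]) (s : ℕ) :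
    cExp p r₀ q₀ s * q₀ = (p ^ s - 1) * r₀ := by
  have h₁ : q₀ ∣ p ^ s - 1 := by
    rw [← Nat.modEq_iff_dvd' (Nat.one_le_pow _ _ hp)]
    simpa using (hcong.pow s).symm
  exact Nat.div_mul_cancel (h₁.mul_right _)

theorem two_mul_cExp_le {p r₀ q₀ : ℕ} (hp : 1 ≤ p) (hq₀ : 0 < q₀) (hω : 2 * r₀ ≤ q₀)
    (hcong : p ≡ 1 [MOD q₀]) (s : ℕ) : 2 * cExp p r₀ q₀ s ≤ p ^ s - 1 := by
  have h := cExp_mul r₀ hp hcong s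
  refine Nat.le_of_mul_le_mul_right ?_ hq₀
  calc 2 * cExp p r₀ q₀ s * q₀ = (p ^ s - 1) * (2 * r₀) := by rw [mul_assoc, h]; ring
    _ ≤ _ := Nat.mul_le_mul_left _ hω

theorem two_mul_bExp_add {p r₀ q₀ : ℕ} (hodd : Odd p) (hq₀ : 0 < q₀) (hω : 2 * r₀ ≤ q₀)
    (hcong : p ≡ 1 [MOD q₀]) (s : ℕ) :
    2 * bExp p r₀ q₀ s + 2 * cExp p r₀ q₀ s = p ^ s - 1 := by
  have h := two_mul_cExp_le hodd.pos hq₀ hω hcong s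
  obtain ⟨t, ht⟩ := hodd.pow (n := s)
  simp only [bExp]
  omega

theorem pow_add_sub_one {p : ℕ} (hp : 1 ≤ p) (s i : ℕ) :
    p ^ (s + i) - 1 = (p ^ s - 1) * p ^ i + (p ^ i - 1) := by
  have h₁ := Nat.one_le_pow s p hp
  have h₂ := Nat.one_le_pow i p hp
  obtain ⟨u, hu⟩ := Nat.exists_eq_add_of_le' h₁
  obtain ⟨v, hv⟩ := Nat.exists_eq_add_of_le' h₂
  rw [pow_add, hu, hv, Nat.add_sub_cancel, Nat.add_sub_cancel, Nat.sub_eq_iff_eq_add (by nlinarith)]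
  ring

theorem expVec_add {p : ℕ} (hp : 1 ≤ p) (k n s i : ℕ) :
    expVec p k n (s + i) = p ^ i • expVec p k n s + (p ^ i - 1) • indVec k n := by
  ext ⟨m, j⟩
  simp only [Finsupp.coe_add, Finsupp.coe_smul, Pi.add_apply, Pi.smul_apply, smul_eq_mul,
    indVec_apply, expVec_apply]
  split_ifs with h
  · have h₁ := Nat.one_le_pow i p hp
    have h₂ : 1 ≤ j * p ^ s := Nat.mul_pos (mem_Icc.1 h).1 (Nat.one_le_pow s p hp)
    have h₃ : p ^ i * 1 ≤ p ^ i * (j * p ^ s) := Nat.mul_le_mul_left _ h₂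
    rw [pow_add, Nat.mul_sub, ← mul_assoc j, mul_comm (j * p ^ s)]
    omega
  · simp

theorem truncEval_add [IsDomain K] [CharZero K] {p r₀ q₀ k n : ℕ} (hodd : Odd p)
    (hq₀ : 0 < q₀) (hω : 2 * r₀ ≤ q₀) (hcong : p ≡ 1 [MOD q₀])
    (hk : 1 ≤ k) (hn : 2 * k ≤ n) {i : ℕ} {q : K} (hq : IsPrimitiveRoot q (p ^ i)) (s : ℕ) (z : K) :
    coeff (expVec p k n 0) (vandEval k n (X : ℕ × ℕ → MvPolynomial (ℕ × ℕ) K)) *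
        truncEval p r₀ q₀ k n (s + i) z q =
      truncEval p r₀ q₀ k n s (z ^ p ^ i) 1 * truncEval p r₀ q₀ k n i z q := by
  have hp : 1 ≤ p := hodd.pos
  have hd : 0 < p ^ i := Nat.one_le_pow i p hp
  have hN := pow_add_sub_one hp s i
  have hc : cExp p r₀ q₀ (s + i) = cExp p r₀ q₀ s * p ^ i + cExp p r₀ q₀ i := by
    refine Nat.eq_of_mul_eq_mul_right hq₀ ?_
    rw [add_mul, mul_right_comm, cExp_mul r₀ hp hcong, cExp_mul r₀ hp hcong,
      cExp_mul r₀ hp hcong, hN]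
    ring
  have hc_le := two_mul_cExp_le hp hq₀ hω hcong
  have hb : bExp p r₀ q₀ (s + i) = bExp p r₀ q₀ s * p ^ i + bExp p r₀ q₀ i := by
    have h₁ := two_mul_bExp_add hodd hq₀ hω hcong s
    have h₂ := two_mul_bExp_add hodd hq₀ hω hcong i
    have h₃ := two_mul_bExp_add hodd hq₀ hω hcong (s + i)
    rw [hN, hc, ← h₁, ← h₂] at h₃
    linarith
  have ha' : ∀ s, aExp p r₀ q₀ s + cExp p r₀ q₀ s = p ^ s - 1 := by
    intro s
    have := hc_le s
    simp only [aExp]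
    omega
  have ha : aExp p r₀ q₀ (s + i) = aExp p r₀ q₀ s * p ^ i + aExp p r₀ q₀ i := by
    have h₃ := ha' (s + i)
    rw [hN, hc, ← ha' s, ← ha' i] at h₃
    linarith
  have hdeg : ∀ v, 1 ≤ v → v - 1 + (aExp p r₀ q₀ i + 2 * (bExp p r₀ q₀ i * (v - 1)) +
      2 * (cExp p r₀ q₀ i * v)) + 1 < (v + 1) * p ^ i := by
    intro v hv
    obtain ⟨w, rfl⟩ := Nat.exists_eq_add_of_le' hv
    have h₁ := two_mul_bExp_add hodd hq₀ hω hcong i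
    have h₂ := ha' i
    have h₃ := hc_le i
    obtain ⟨N, hN'⟩ := Nat.exists_eq_add_of_le' (show 1 ≤ p ^ i from hd)
    rw [hN', Nat.add_sub_cancel] at h₁ h₂ h₃
    rw [hN', Nat.add_sub_cancel]
    have h₄ : (2 * bExp p r₀ q₀ i + 2 * cExp p r₀ q₀ i) * w = N * w := by rw [h₁]
    nlinarith
  have hsplit := phibarEval_mul_add (A := MvPolynomial (ℕ × ℕ) K) (q := C q)
    (by rw [← C_pow, hq.pow_eq_one, C_1])
    ((hq.map_of_injective (f := (C : K →+* MvPolynomial (ℕ × ℕ) K))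
      (C_injective _ _)).qDiff_eq hd)
    k n (aExp p r₀ q₀ s) (aExp p r₀ q₀ i) (bExp p r₀ q₀ s) (bExp p r₀ q₀ i)
    (cExp p r₀ q₀ s) (cExp p r₀ q₀ i) X (C z)
  have hexp : phibarEval k n (aExp p r₀ q₀ s) (bExp p r₀ q₀ s) (cExp p r₀ q₀ s)
      (fun x => (X x : MvPolynomial (ℕ × ℕ) K) ^ p ^ i) (C z ^ p ^ i) 1 =
      expand (p ^ i) (phibarEval k n (aExp p r₀ q₀ s) (bExp p r₀ q₀ s) (cExp p r₀ q₀ s)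
        X (C (z ^ p ^ i)) (C 1)) := by
    change _ = (expand (p ^ i)).toRingHom _
    rw [map_phibarEval]
    simp
  have hmain := coeff_mul_phiPoly_eq hk hn p hd hdeg z q
    (phibarEval k n (aExp p r₀ q₀ s) (bExp p r₀ q₀ s) (cExp p r₀ q₀ s) X (C (z ^ p ^ i)) (C 1))
    (expVec p k n s)
  rw [← expVec_add hp, ← expVec_add hp, zero_add, ← hexp, mul_comm _ (vandEval k n X)] at hmain
  rw [truncEval, truncEval, truncEval, ha, hb, hc]
  refine Eq.trans ?_ hmain
  rw [phiPoly, hsplit, phiPoly, mul_left_comm]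

end Truncation

section Specialization

/-- The specialization `z ↦ t`, `q ↦ w` of `ℤ[z,q]`. -/
noncomputable def specialize {K : Type*} [CommRing K] (t w : K) : Zq →+* K :=
  eval₂Hom (Int.castRingHom K) (fun b => bif b then w else t)

@[simp] theorem specialize_Zvar {K : Type*} [CommRing K] (t w : K) :
    specialize t w Zvar = t := by
  simp [specialize, Zvar]

@[simp] theorem specialize_Qvar {K : Type*} [CommRing K] (t w : K) :
    specialize t w Qvar = w := by
  simp [specialize, Qvar]

theorem specialize_frobZq {K : Type*} [CommRing K] (p : ℕ) (t w : K) (f : Zq) :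
    specialize t w (frobZq p f) = specialize (t ^ p) (w ^ p) f := by
  have h : (specialize t w).comp (frobZq p) = specialize (t ^ p) (w ^ p) := by
    refine ringHom_ext (fun _ => by simp) fun b => ?_
    cases b <;> simp [specialize, frobZq]
  exact RingHom.congr_fun h f

/-- The algebraic closure of `ℚ(z)`. -/
abbrev SpecField : Type := AlgebraicClosure (FractionRing (MvPolynomial Unit ℤ))

/-- The bijection which singles out `true`, the index of `q`. -/
def boolEquivOptionUnit : Bool ≃ Option Unit where
  toFun b := bif b then none else some ()
  invFun o := o.isNone
  left_inv b := by cases b <;> rfl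
  right_inv o := by cases o <;> rfl

/-- The identification of `ℤ[z,q]` with `ℤ[z][q]`. -/
noncomputable def zqEquiv : Zq ≃ₐ[ℤ] Polynomial (MvPolynomial Unit ℤ) :=
  (renameEquiv ℤ boolEquivOptionUnit).trans (optionEquivLeft ℤ Unit)

theorem geom_sum_Qvar_dvd {N : ℕ} (hN : 0 < N) {f : Zq}
    (h : ∀ w : SpecField, w ^ N = 1 → w ≠ 1 →
      specialize (algebraMap (MvPolynomial Unit ℤ) SpecField (X ())) w f = 0) :
    (∑ i ∈ range N, Qvar ^ i) ∣ f := by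
  set ι := algebraMap (MvPolynomial Unit ℤ) SpecField with hι
  have hι' : Function.Injective ι := by
    rw [hι, IsScalarTower.algebraMap_eq (MvPolynomial Unit ℤ)
      (FractionRing (MvPolynomial Unit ℤ)) SpecField, RingHom.coe_comp]
    exact (FaithfulSMul.algebraMap_injective (FractionRing _) SpecField).comp (IsFractionRing.injective _ _)
  have hQ : zqEquiv Qvar = Polynomial.X := by
    simp [zqEquiv, Qvar, boolEquivOptionUnit]
  have hZ : zqEquiv Zvar = Polynomial.C (X ()) := by
    simp [zqEquiv, Zvar, boolEquivOptionUnit]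
  rw [← map_dvd_iff zqEquiv, map_sum]
  simp only [map_pow, hQ]
  rw [← Polynomial.map_dvd_map ι hι' (Polynomial.monic_geom_sum_X hN.ne')]
  simp only [Polynomial.map_sum, Polynomial.map_pow, Polynomial.map_X]
  have heval : ∀ w, ((zqEquiv f).map ι).eval w = specialize (ι (X ())) w f := by
    intro w
    have h : ((Polynomial.evalRingHom w).comp (Polynomial.mapRingHom ι)).comp
        (zqEquiv : Zq →+* Polynomial (MvPolynomial Unit ℤ)) = specialize (ι (X ())) w := by
      refine ringHom_ext (fun _ => by simp) fun b => ?_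
      cases b
      · change Polynomial.eval w ((zqEquiv Zvar).map ι) = specialize (ι (X ())) w Zvar
        simp [hZ]
      · change Polynomial.eval w ((zqEquiv Qvar).map ι) = specialize (ι (X ())) w Qvar
        simp [hQ]
    exact RingHom.congr_fun h f
  by_cases h₀ : (zqEquiv f).map ι = 0
  · rw [h₀]
    exact dvd_zero _
  have hgeom : (∑ i ∈ range N, (Polynomial.X : Polynomial SpecField) ^ i) * (Polynomial.X - 1) =
      Polynomial.X ^ N - 1 := geom_sum_mul _ _
  have hsep : (∑ i ∈ range N, (Polynomial.X : Polynomial SpecField) ^ i).Separable := by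
    refine Polynomial.Separable.of_mul_left (g := Polynomial.X - 1) ?_
    rw [hgeom]
    exact Polynomial.separable_X_pow_sub_C 1 (by exact_mod_cast hN.ne') one_ne_zero
  refine (IsAlgClosed.splits _).dvd_of_roots_le_roots
    (Polynomial.monic_geom_sum_X hN.ne').ne_zero ?_
  rw [Multiset.le_iff_subset (Polynomial.nodup_roots hsep)]
  intro w hw
  have hw' := Polynomial.isRoot_of_mem_roots hw
  rw [Polynomial.IsRoot, Polynomial.eval_finsetSum] at hw'
  simp only [Polynomial.eval_pow, Polynomial.eval_X] at hw'
  rw [Polynomial.mem_roots h₀, Polynomial.IsRoot, heval]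
  refine h w ?_ ?_
  · rw [← sub_eq_zero, ← geom_sum_mul, hw', zero_mul]
  · rintro rfl
    simp [hN.ne'] at hw'

end Specialization

/-- **q-deformed Dwork congruence** (Theorem 1 of the paper): for every `s ≥ 1`,
`[p^s]_q` divides `T_{s+1}(z,q)·T_{s-1}(z^p,q^p) - T_s(z,q)·T_s(z^p,q^p)` in `ℤ[z,q]`. -/
theorem q_dwork_congruence (p r₀ q₀ k n : ℕ) (hp : p.Prime) (hodd : Odd p)
    (hr₀ : 0 < r₀) (hq₀ : 0 < q₀) (hω : 2 * r₀ ≤ q₀) (hcong : p ≡ 1 [MOD q₀])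
    (hk : 1 ≤ k) (hn : 2 * k ≤ n) (s : ℕ) (hs : 1 ≤ s) :
    (∑ i ∈ range (p ^ s), Qvar ^ i) ∣
      Ts p r₀ q₀ k n (s + 1) * frobZq p (Ts p r₀ q₀ k n (s - 1)) -
        Ts p r₀ q₀ k n s * frobZq p (Ts p r₀ q₀ k n s) := by
  refine geom_sum_Qvar_dvd (pow_pos hp.pos s) fun w hw hw₁ => ?_
  generalize algebraMap (MvPolynomial Unit ℤ) SpecField (X ()) = t
  have hprim := IsPrimitiveRoot.orderOf w
  obtain ⟨i, hi, hord⟩ := (Nat.dvd_prime_pow hp).1 (orderOf_dvd_of_pow_eq_one hw)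
  rw [hord] at hprim
  obtain _ | i := i
  · rw [pow_zero, IsPrimitiveRoot.one_right_iff] at hprim
    exact absurd hprim hw₁
  obtain ⟨s, rfl⟩ := Nat.exists_eq_add_of_le' hi
  have hprim' : IsPrimitiveRoot (w ^ p) (p ^ i) :=
    hprim.pow (pow_pos hp.pos _) (pow_succ' p i)
  have hV := coeff_vandEval_ne_zero (K := SpecField) hk hn p
  have key := fun s => truncEval_add hodd hq₀ hω hcong hk hn hprim s t
  have key' := fun s => truncEval_add hodd hq₀ hω hcong hk hn hprim' s (t ^ p)
  simp only [← pow_mul, ← pow_succ'] at key'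
  have h₁ := key (s + 1)
  have h₂ := key' s
  have h₃ := key s
  have h₄ := key' (s + 1)
  simp only [map_sub, map_mul, specialize_frobZq]
  simp only [map_Ts, specialize_Zvar, specialize_Qvar]
  rw [show s + (i + 1) + 1 = s + 1 + (i + 1) by ring, show s + (i + 1) - 1 = s + i by omega]
  rw [show s + 1 + i = s + (i + 1) by ring] at h₄
  refine (mul_eq_zero.1 ?_).resolve_left (mul_ne_zero hV hV)
  rw [mul_sub, mul_mul_mul_comm _ _ (truncEval p r₀ q₀ k n (s + 1 + (i + 1)) t w),
    mul_mul_mul_comm _ _ (truncEval p r₀ q₀ k n (s + (i + 1)) t w), h₁, h₂, h₃, h₄]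
  ring
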